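/- Let m be odd and let d be an odd integer with 2 ≤ d ≤ 2^m - 2. If tr(x^d + (x+1)^d + 1) = 0 for all x ∈ GF(2^m), then d = 2^k + 1 for some positive integer k. -/

import Mathlib

attribute [local instance] Classical.propDecidable

noncomputable instance (m : ℕ) : Fintype (GaloisField 2 m) := Fintype.ofFinite _

/-- The absolute trace map from `GF(2^m)` to `GF(2)`. -/
noncomputable def tr (m : ℕ) (x : GaloisField 2 m) : ZMod 2 :=
  Algebra.trace (ZMod 2) (GaloisField 2 m) x

/-- `(-1)^t` as an integer, for `t ∈ GF(2)`. -/
def chi (t : ZMod 2) : ℤ := (-1) ^ t.val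

/-- The Walsh coefficient `∑_{x ∈ F} (-1)^(tr(γx + βx^d))` of the power map `x ↦ x^d`. -/
noncomputable def walsh (m d : ℕ) (β γ : GaloisField 2 m) : ℤ :=
  ∑ x : GaloisField 2 m, chi (tr m (γ * x + β * x ^ d))

/-- The power function `x ↦ x^d` on `GF(2^m)` is maximum nonlinear (almost bent). -/
def MaxNonlinear (m d : ℕ) : Prop :=
  ∀ β : GaloisField 2 m, β ≠ 0 → ∀ γ : GaloisField 2 m,
    walsh m d β γ ∈ ({0, 2 ^ ((m + 1) / 2), -(2 ^ ((m + 1) / 2))} : Set ℤ)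

/-- `D_d = {x ∈ F : tr(x^d) = 1}`. -/
noncomputable def Dd (m d : ℕ) : Finset (GaloisField 2 m) :=
  Finset.univ.filter (fun x => tr m (x ^ d) = 1)

/-- `H^i(α) = {x ∈ F : tr(αx) = i}`. -/
noncomputable def Hi (m : ℕ) (α : GaloisField 2 m) (i : ZMod 2) :
    Finset (GaloisField 2 m) :=
  Finset.univ.filter (fun x => tr m (α * x) = i)

/-- `H^{i,j}(α,β) = {x ∈ F : tr(αx) = i and tr(βx) = j}`. -/
noncomputable def Hij (m : ℕ) (α β : GaloisField 2 m) (i j : ZMod 2) :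
    Finset (GaloisField 2 m) :=
  Finset.univ.filter (fun x => tr m (α * x) = i ∧ tr m (β * x) = j)

open scoped Pointwise

/-- If every nonempty set smaller than `S` has an even number of translates inside `S`, in a group
of odd order, then `S` has at most two elements. -/
theorem card_le_two_of_even_card_translates {G : Type*} [AddCommGroup G] [Fintype G]
    [DecidableEq G] (hG : Odd (Fintype.card G)) (S : Finset G)
    (heven : ∀ U : Finset G, U.Nonempty → U.card < S.card →
      Even (Finset.univ.filter fun t : G => t +ᵥ U ⊆ S).card) :
    S.card ≤ 2 := by
  by_contra! hS
  have hSeven : Even S.card := by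
    have h := heven {0} (by simp) (by simp; omega)
    simpa using h
  have hinter (u : G) (hu : u ≠ 0) : Even (S ∩ (u +ᵥ S)).card := by
    have h := heven {0, -u} (by simp) (by
      have := Finset.card_le_two (a := (0 : G)) (b := -u)
      omega)
    convert h using 2
    ext t
    simp [Finset.vadd_finset_insert, Finset.insert_subset_iff,
      ← Finset.neg_vadd_mem_iff, add_comm]
  obtain ⟨a, ha⟩ : S.Nonempty := Finset.card_pos.mp (by omega)
  have hcard := Finset.card_erase_of_mem ha
  have h := heven (S.erase a) (Finset.card_pos.mp (by omega)) (by omega)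
  have hstab (t : G) : t +ᵥ S.erase a ⊆ S ↔ t ∈ AddAction.stabilizer G S := by
    rw [AddAction.mem_stabilizer_iff]
    refine ⟨fun ht => ?_, fun ht => ?_⟩
    · rcases eq_or_ne t 0 with rfl | ht0
      · simp
      have hle : (t +ᵥ S.erase a).card ≤ (S ∩ (t +ᵥ S)).card :=
        Finset.card_le_card (Finset.subset_inter ht
          (Finset.vadd_finset_subset_vadd_finset (Finset.erase_subset a S)))
      rw [Finset.card_vadd_finset] at hle
      have hle' : (S ∩ (t +ᵥ S)).card ≤ S.card := Finset.card_le_card Finset.inter_subset_left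
      have heq : (S ∩ (t +ᵥ S)).card = S.card := by
        have := hinter t ht0
        grind
      have hsub : S ⊆ t +ᵥ S := by
        rw [← Finset.inter_eq_left]
        exact Finset.eq_of_subset_of_card_le Finset.inter_subset_left heq.ge
      exact (Finset.eq_of_subset_of_card_le hsub (by simp)).symm
    · conv_rhs => rw [← ht]
      exact Finset.vadd_finset_subset_vadd_finset (Finset.erase_subset a S)
  have hdvd := AddSubgroup.card_addSubgroup_dvd_card (AddAction.stabilizer G S)
  rw [Nat.card_eq_fintype_card (α := G)] at hdvd
  refine Nat.not_even_iff_odd.mpr (hG.of_dvd_nat hdvd) ?_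
  convert h using 1
  simp only [hstab]
  rw [Nat.card_eq_fintype_card, Fintype.card_subtype]

/-- The natural number whose binary digits equal to one are at the positions in `S`. -/
def binarySum {m : ℕ} (S : Finset (ZMod m)) : ℕ := ∑ a ∈ S, 2 ^ a.val

theorem binarySum_eq_sum_image {m : ℕ} [NeZero m] (S : Finset (ZMod m)) :
    binarySum S = ∑ i ∈ S.image ZMod.val, 2 ^ i := by
  rw [binarySum, Finset.sum_image (ZMod.val_injective m).injOn]

theorem binarySum_lt {m : ℕ} [NeZero m] (S : Finset (ZMod m)) : binarySum S < 2 ^ m := by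
  rw [binarySum_eq_sum_image]
  exact Nat.geomSum_lt le_rfl (by simp [ZMod.val_lt])

theorem binarySum_injective {m : ℕ} [NeZero m] :
    Function.Injective (binarySum : Finset (ZMod m) → ℕ) := by
  intro S T h
  rw [binarySum_eq_sum_image, binarySum_eq_sum_image] at h
  exact Finset.image_injective (ZMod.val_injective m) (Finset.geomSum_injective le_rfl h)

theorem exists_binarySum_eq {m : ℕ} [NeZero m] {d : ℕ} (hd : d < 2 ^ m) :
    ∃ S : Finset (ZMod m), binarySum S = d := by
  have hsurj : Function.Surjective
      (fun S : Finset (ZMod m) => (⟨binarySum S, binarySum_lt S⟩ : Fin (2 ^ m))) := by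
    refine ((Fintype.bijective_iff_injective_and_card _).mpr ⟨fun S T h => ?_, by simp [ZMod.card]⟩).2
    exact binarySum_injective (Fin.mk.inj h)
  obtain ⟨S, hS⟩ := hsurj ⟨d, hd⟩
  exact ⟨S, Fin.mk.inj hS⟩

theorem exists_eq_two_pow_add_one_of_card_le_two {m : ℕ} [NeZero m] {S : Finset (ZMod m)}
    (hS : S.card ≤ 2) (hodd : Odd (binarySum S)) (htwo : 2 ≤ binarySum S) :
    ∃ k : ℕ, 0 < k ∧ binarySum S = 2 ^ k + 1 := by
  have h0 : (0 : ZMod m) ∈ S := by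
    by_contra h0
    refine Nat.not_even_iff_odd.mpr hodd (Finset.even_sum _ fun a ha => ?_)
    refine (even_two).pow_of_ne_zero ?_
    rw [Ne, ZMod.val_eq_zero]
    rintro rfl
    exact h0 ha
  have hsum : binarySum S = binarySum (S.erase 0) + 1 := by
    simp [binarySum, ← Finset.sum_erase_add _ _ h0]
  have hcard := Finset.card_erase_of_mem h0
  obtain h | h : (S.erase 0).card = 0 ∨ (S.erase 0).card = 1 := by omega
  · rw [Finset.card_eq_zero] at h
    rw [hsum, h] at htwo
    simp [binarySum] at htwo
  · obtain ⟨a, ha⟩ := Finset.card_eq_one.mp h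
    have ha0 : a ≠ 0 := Finset.ne_of_mem_erase (ha ▸ Finset.mem_singleton_self a)
    refine ⟨a.val, Nat.pos_of_ne_zero (by rwa [Ne, ZMod.val_eq_zero]), ?_⟩
    rw [hsum, ha]
    simp [binarySum]

section GaloisField

variable {m : ℕ}

theorem galoisField_pow_two_pow_mod [NeZero m] (x : GaloisField 2 m) (n : ℕ) :
    x ^ 2 ^ (n % m) = x ^ 2 ^ n := by
  have hx (y : GaloisField 2 m) : y ^ 2 ^ m = y := by
    have := FiniteField.pow_card y
    rwa [← Nat.card_eq_fintype_card, GaloisField.card 2 m (NeZero.ne m)] at this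
  conv_rhs => rw [← Nat.mod_add_div n m, pow_add, pow_mul, pow_mul 2 m]
  induction n / m with
  | zero => simp
  | succ k ih => rw [pow_succ, pow_mul _ _ (2 ^ m), hx, ← ih]

theorem algebraMap_tr [NeZero m] (x : GaloisField 2 m) :
    algebraMap (ZMod 2) (GaloisField 2 m) (tr m x) = ∑ t : ZMod m, x ^ 2 ^ t.val := by
  rw [tr, FiniteField.algebraMap_trace_eq_sum_pow, GaloisField.finrank 2 (NeZero.ne m),
    Nat.card_zmod]
  refine (Finset.sum_nbij ZMod.val ?_ (ZMod.val_injective m).injOn ?_ ?_).symm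
  · simp [ZMod.val_lt]
  · intro i hi
    exact ⟨i, by simp, ZMod.val_cast_of_lt (by simpa using hi)⟩
  · simp

theorem pow_binarySum_vadd [NeZero m] (x : GaloisField 2 m) (t : ZMod m) (S : Finset (ZMod m)) :
    x ^ binarySum (t +ᵥ S) = (x ^ binarySum S) ^ 2 ^ t.val := by
  rw [binarySum, binarySum, ← Finset.prod_pow_eq_pow_sum, ← Finset.prod_pow_eq_pow_sum,
    ← Finset.prod_pow, Finset.vadd_finset_def, Finset.prod_image (AddAction.injective t).injOn]
  refine Finset.prod_congr rfl fun a _ => ?_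
  rw [vadd_eq_add, ZMod.val_add, galoisField_pow_two_pow_mod, ← pow_mul, ← pow_add, add_comm]

theorem add_one_pow_binarySum (x : GaloisField 2 m) (S : Finset (ZMod m)) :
    (x + 1) ^ binarySum S = ∑ T ∈ S.powerset, x ^ binarySum T := by
  simp only [binarySum, ← Finset.prod_pow_eq_pow_sum, add_pow_char_pow, one_pow]
  rw [Finset.prod_add_one]

open Polynomial in
theorem even_card_of_sum_pow_eq_zero [NeZero m] {ι : Type*} (s : Finset ι) (e : ι → ℕ)
    (he : ∀ i ∈ s, e i < 2 ^ m) (hs : ∀ x : GaloisField 2 m, ∑ i ∈ s, x ^ e i = 0) (n : ℕ) :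
    Even (s.filter fun i => e i = n).card := by
  have hp : ∑ i ∈ s, (X : (GaloisField 2 m)[X]) ^ e i = 0 := by
    refine eq_zero_of_natDegree_lt_card_of_eval_eq_zero _ Function.injective_id
      (fun x => by simpa [eval_finsetSum] using hs x) ?_
    rw [← Nat.card_eq_fintype_card, GaloisField.card 2 m (NeZero.ne m)]
    refine (natDegree_sum_le_of_forall_le (n := 2 ^ m - 1) _ _ fun i hi => ?_).trans_lt
      (Nat.sub_lt (by positivity) one_pos)
    have := he i hi
    rw [natDegree_X_pow]
    omega
  have hc := congrArg (fun p => coeff p n) hp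
  simp only [finsetSum_coeff, coeff_X_pow, coeff_zero, Finset.sum_boole] at hc
  rw [CharP.cast_eq_zero_iff (GaloisField 2 m) 2] at hc
  rw [even_iff_two_dvd]
  simpa [eq_comm] using hc

theorem even_card_translates_subset [NeZero m] {S : Finset (ZMod m)}
    (htr : ∀ x : GaloisField 2 m,
      tr m (x ^ binarySum S + (x + 1) ^ binarySum S + 1) = 0)
    {U : Finset (ZMod m)} (hU : U.Nonempty) (hUS : U.card < S.card) :
    Even (Finset.univ.filter fun t : ZMod m => t +ᵥ U ⊆ S).card := by
  have hS : S ≠ ∅ := by rintro rfl; simp at hUS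
  have hsplit (x : GaloisField 2 m) : x ^ binarySum S + (x + 1) ^ binarySum S + 1 =
      ∑ T ∈ S.ssubsets.erase ∅, x ^ binarySum T := by
    have h1 : (x + 1) ^ binarySum S =
        ∑ T ∈ S.ssubsets.erase ∅, x ^ binarySum T + 1 + x ^ binarySum S := by
      rw [add_one_pow_binarySum, Finset.ssubsets,
        ← Finset.sum_erase_add _ _ (Finset.mem_powerset_self S),
        ← Finset.sum_erase_add (S.powerset.erase S) _ (a := ∅) (by simp [hS.symm])]
      simp [binarySum]
    rw [h1]
    linear_combination (1 + x ^ binarySum S) * CharTwo.two_eq_zero (R := GaloisField 2 m)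
  have hsum (x : GaloisField 2 m) :
      ∑ p ∈ S.ssubsets.erase ∅ ×ˢ (Finset.univ : Finset (ZMod m)),
        x ^ binarySum (p.2 +ᵥ p.1) = 0 := by
    have h := congrArg (algebraMap (ZMod 2) (GaloisField 2 m)) (htr x)
    rw [hsplit, algebraMap_tr, map_zero] at h
    rw [Finset.sum_product_right, ← h]
    refine Finset.sum_congr rfl fun t _ => ?_
    simp only [pow_binarySum_vadd, sum_pow_char_pow]
  have h := even_card_of_sum_pow_eq_zero _ _ (fun p _ => binarySum_lt (p.2 +ᵥ p.1)) hsum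
    (binarySum U)
  convert h using 1
  refine Finset.card_nbij' (fun t => (t +ᵥ U, -t)) (fun p => -p.2) ?_ ?_ ?_ ?_
  · intro t ht
    have ht' : t +ᵥ U ⊆ S := by simpa using ht
    have hne : t +ᵥ U ≠ S := by
      intro h
      rw [← h, Finset.card_vadd_finset] at hUS
      exact hUS.false
    simp [Finset.mem_ssubsets, ht'.ssubset_of_ne hne, hU.ne_empty]
  · rintro ⟨T, t⟩ hp
    simp only [Finset.coe_filter, Set.mem_ofPred_eq, Finset.mem_product, Finset.mem_erase,
      Finset.mem_ssubsets, binarySum_injective.eq_iff] at hp ⊢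
    simp [← hp.2, hp.1.1.2.subset]
  · intro t _
    simp
  · rintro ⟨T, t⟩ hp
    simp only [Finset.coe_filter, Set.mem_ofPred_eq, binarySum_injective.eq_iff] at hp
    simp [← hp.2]

end GaloisField

/-- If `m` is odd, `d` is odd with `2 ≤ d ≤ 2^m - 2`, and
`tr(x^d + (x+1)^d + 1) = 0` for all `x ∈ GF(2^m)`, then `d = 2^k + 1` for some `k ≥ 1`. -/
theorem stmt4 (m : ℕ) (hmodd : Odd m) (d : ℕ) (hdodd : Odd d)
    (hd2 : 2 ≤ d) (hdle : d ≤ 2 ^ m - 2)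
    (htr : ∀ x : GaloisField 2 m, tr m (x ^ d + (x + 1) ^ d + 1) = 0) :
    ∃ k : ℕ, 0 < k ∧ d = 2 ^ k + 1 := by
  have : NeZero m := ⟨hmodd.pos.ne'⟩
  obtain ⟨S, rfl⟩ := exists_binarySum_eq (m := m) (d := d) (by omega)
  refine exists_eq_two_pow_add_one_of_card_le_two ?_ hdodd hd2
  refine card_le_two_of_even_card_translates (by rwa [ZMod.card]) S fun U hU hUS => ?_
  exact even_card_translates_subset htr hU hUS
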